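/- arXiv:1202.1969 — 4 statements merged into one kernel-verified Lean document; each statement's English description precedes it below -/
import Mathlib

section
/- Let p be a prime and let W, Q ∈ ℂ_p be 1-units. Fix n ∈ ℕ and a ∈ ℕ with 0 ≤ a < p^n, set ω = W^{p^n} and q = Q^{p^n}, and let f : ℤ_p → ℂ_p. If the limit I = lim_{m→∞} (1/[p^m]_q) Σ_{j=0}^{p^m−1} ω^j f(a + p^n j) exists in ℂ_p, then the limit lim_{m→∞} (1/[p^{m+n}]_Q) Σ_{j=0}^{p^m−1} W^{a+p^n j} f(a + p^n j) also exists and equals (W^a / [p^n]_Q) · I. (This is the identity ∫_{a+p^nℤ_p} ω^{ξ/p^n} f(ξ) q^{−ξ/p^n} dμ_{q^{p^{−n}}}(ξ) = (ω^{a/p^n}/[p^n]_{q^{p^{−n}}}) ∫_{ℤ_p} ω^ξ f(a+p^nξ) q^{−ξ} dμ_q(ξ), where the factor q^{−ξ} cancels against the weight q^ξ of the measure μ_q.) -/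
/-!
STATEMENT 3: the change-of-variables identity
`∫_{a+p^nℤ_p} ω^{ξ/p^n} f(ξ) q^{−ξ/p^n} dμ_{q^{p^{−n}}}(ξ)
   = (ω^{a/p^n}/[p^n]_{q^{p^{−n}}}) ∫_{ℤ_p} ω^ξ f(a+p^nξ) q^{−ξ} dμ_q(ξ)`,
phrased with `W = ω^{1/p^n}`, `Q = q^{1/p^n}` (so `ω = W^{p^n}`, `q = Q^{p^n}`):
if `I = lim_m (1/[p^m]_q) Σ_{j<p^m} ω^j f(a + p^n j)` exists, then
`lim_m (1/[p^{m+n}]_Q) Σ_{j<p^m} W^(a+p^n j) f(a + p^n j)` exists and equals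
`(W^a / [p^n]_Q) * I`.  (The weight `Q^{a+p^n j}` of the measure `μ_Q` has been
cancelled against the integrand factor `q^{-ξ/p^n}`, as in the paper's proof.)

`ℂ_p` is modelled as a complete nonarchimedean normed field `K`;
`[x]_q = (1 - q^x)/(1 - q)`.
-/

open Filter

/-- The `q`-analogue `[x]_q = (1 - q^x)/(1 - q)`. -/
noncomputable def qAnalogue {K : Type*} [Field K] (q : K) (x : ℕ) : K :=
  (1 - q ^ x) / (1 - q)

/-- Multiplicativity of `q`-analogues: `[xy]_q = [x]_q [y]_{q^x}`. It also holds in the degenerate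
case `q ^ x = 1`, where both sides vanish. -/
theorem qAnalogue_mul {K : Type*} [Field K] (q : K) (x y : ℕ) :
    qAnalogue q (x * y) = qAnalogue q x * qAnalogue (q ^ x) y := by
  unfold qAnalogue
  rw [pow_mul]
  by_cases h : q ^ x = 1
  · simp [h]
  · rw [mul_comm, div_mul_div_cancel₀ (sub_ne_zero.mpr (Ne.symm h))]

theorem volkenborn_integral_ball_eq
    (p : ℕ) [Fact p.Prime] {K : Type*} [NormedField K] [IsUltrametricDist K]
    [CompleteSpace K]
    (W Q : K) (hW : ‖1 - W‖ < 1) (hQ : ‖1 - Q‖ < 1)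
    (n a : ℕ) (ha : a < p ^ n)
    (f : ℤ_[p] → K) (I : K)
    (hI : Tendsto
      (fun m => (qAnalogue (Q ^ p ^ n) (p ^ m))⁻¹ *
        ∑ j ∈ Finset.range (p ^ m),
          (W ^ p ^ n) ^ j * f ((a + p ^ n * j : ℕ) : ℤ_[p]))
      atTop (nhds I)) :
    Tendsto
      (fun m => (qAnalogue Q (p ^ (m + n)))⁻¹ *
        ∑ j ∈ Finset.range (p ^ m),
          W ^ (a + p ^ n * j) * f ((a + p ^ n * j : ℕ) : ℤ_[p]))
      atTop (nhds (W ^ a / qAnalogue Q (p ^ n) * I)) := by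
  refine (hI.const_mul (W ^ a / qAnalogue Q (p ^ n))).congr fun m => ?_
  have hsum : ∑ j ∈ Finset.range (p ^ m),
        W ^ (a + p ^ n * j) * f ((a + p ^ n * j : ℕ) : ℤ_[p]) =
      W ^ a * ∑ j ∈ Finset.range (p ^ m),
        (W ^ p ^ n) ^ j * f ((a + p ^ n * j : ℕ) : ℤ_[p]) := by
    rw [Finset.mul_sum]
    refine Finset.sum_congr rfl fun j _ => ?_
    rw [pow_add, pow_mul, mul_assoc]
  rw [hsum, add_comm m n, pow_add p n m, qAnalogue_mul, mul_inv, div_eq_mul_inv]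
  ring
end

section
/- Let p be a prime and let W, Q ∈ ℂ_p be 1-units. Fix n ∈ ℕ and a ∈ ℕ with 0 ≤ a < p^n, set ω = W^{p^n} and q = Q^{p^n}, and assume Q ≠ 1, ωq ≠ 1, and q^{p^m} ≠ 1 for all m ∈ ℕ. If the limit L = lim_{m→∞} (1 − (ωq)^{p^m})/(1 − q^{p^m}) exists in ℂ_p, then lim_{m→∞} (1/[p^{m+n}]_Q) Σ_{j=0}^{p^m−1} W^{a+p^n j} Q^{a+p^n j} exists and equals ( W^a Q^a (1 − q) / ( [p^n]_Q (1 − ωq) ) ) · L. (The paper identifies L with 1 + log ω / log q, where log is the p-adic logarithm.) -/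
/-!
STATEMENT 5: evaluation of `∫_{a+p^nℤ_p} ω^{ξ/p^n} dμ_{q^{p^{−n}}}(ξ)`:
with `ω = W^{p^n}`, `q = Q^{p^n}`, if
`L = lim_m (1 − (ωq)^{p^m})/(1 − q^{p^m})` exists, then
`lim_m (1/[p^{m+n}]_Q) Σ_{j<p^m} W^{a+p^n j} Q^{a+p^n j}` exists and equals
`(W^a Q^a (1−q) / ([p^n]_Q (1−ωq))) * L`.

`ℂ_p` is modelled as a complete nonarchimedean normed field `K`;
`[x]_q = (1 - q^x)/(1 - q)`.
-/

open Filter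

theorem weighted_measure_of_one_eval
    (p : ℕ) [Fact p.Prime] {K : Type*} [NormedField K] [IsUltrametricDist K]
    [CompleteSpace K]
    (W Q : K) (hW : ‖1 - W‖ < 1) (hQ : ‖1 - Q‖ < 1)
    (n a : ℕ) (ha : a < p ^ n)
    (ω q : K) (hω : ω = W ^ p ^ n) (hq : q = Q ^ p ^ n)
    (hQ1 : Q ≠ 1) (hωq : ω * q ≠ 1) (hqm : ∀ m : ℕ, q ^ p ^ m ≠ 1)
    (L : K)
    (hL : Tendsto (fun m => (1 - (ω * q) ^ p ^ m) / (1 - q ^ p ^ m)) atTop (nhds L)) :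
    Tendsto
      (fun m => (qAnalogue Q (p ^ (m + n)))⁻¹ *
        ∑ j ∈ Finset.range (p ^ m), W ^ (a + p ^ n * j) * Q ^ (a + p ^ n * j))
      atTop
      (nhds (W ^ a * Q ^ a * (1 - q) / (qAnalogue Q (p ^ n) * (1 - ω * q)) * L)) := by
  have hq1 : q ≠ 1 := by simpa using hqm 0
  have hQ' : 1 - Q ≠ 0 := sub_ne_zero.mpr hQ1.symm
  have hq' : 1 - q ≠ 0 := sub_ne_zero.mpr hq1.symm
  have hωq' : 1 - ω * q ≠ 0 := sub_ne_zero.mpr hωq.symm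
  refine (hL.const_mul
    (W ^ a * Q ^ a * (1 - q) / (qAnalogue Q (p ^ n) * (1 - ω * q)))).congr fun m => ?_
  have hm : 1 - q ^ p ^ m ≠ 0 := sub_ne_zero.mpr (hqm m).symm
  have hpow : Q ^ p ^ (m + n) = q ^ p ^ m := by
    rw [hq, ← pow_mul, ← pow_add, add_comm]
  have hterm (j : ℕ) :
      W ^ (a + p ^ n * j) * Q ^ (a + p ^ n * j) = W ^ a * Q ^ a * (ω * q) ^ j := by
    rw [hω, hq, pow_add, pow_add, pow_mul, pow_mul, mul_pow]
    ring
  have hsum : ∑ j ∈ Finset.range (p ^ m), (ω * q) ^ j =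
      (1 - (ω * q) ^ p ^ m) / (1 - ω * q) :=
    eq_div_of_mul_eq hωq' (geom_sum_mul_neg _ _)
  simp only [hterm, ← Finset.mul_sum, hsum, qAnalogue, hpow, ← hq]
  field_simp
end

section
/- Let p be a prime and let W, Q ∈ ℂ_p be 1-units. Fix n ∈ ℕ and a ∈ ℕ with 0 ≤ a < p^n, set ω = W^{p^n} and q = Q^{p^n}, and assume Q ≠ 1, ωq ≠ 1, and q^{p^m} ≠ 1 for all m ∈ ℕ. Let f : ℤ_p → ℂ_p. Assume (i) the limit L = lim_{m→∞} (1 − (ωq)^{p^m})/(1 − q^{p^m}) exists and L ≠ 0, and (ii) the limit I = lim_{m→∞} (1/[p^m]_q) Σ_{j=0}^{p^m−1} ω^j f(a + p^n j) exists. Let N = lim_{m→∞} (1/[p^{m+n}]_Q) Σ_{j=0}^{p^m−1} W^{a+p^n j} f(a + p^n j) and D = lim_{m→∞} (1/[p^{m+n}]_Q) Σ_{j=0}^{p^m−1} W^{a+p^n j} Q^{a+p^n j} (both limits exist under these hypotheses, and D ≠ 0). Then N / D = ( (1 − ωq) / ( (1 − q) L ) ) · Q^{−a} · I. (N/D is the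 term indexed by n in the weighted q-Hardy–Littlewood-type maximal operator M^{(ω)}_{p,q} f(a) = sup_n (1/μ^{(ω^{p^{−n}})}_{1,q^{p^{−n}}}(a + p^nℤ_p)) ∫_{a+p^nℤ_p} ω^{x/p^n} q^{−x/p^n} f(x) dμ_{q^{p^{−n}}}(x).) -/
/-!
STATEMENT 7: the term indexed by `n` of the weighted `q`-Hardy–Littlewood-type
maximal operator.  With `ω = W^{p^n}`, `q = Q^{p^n}`, assuming
`L = lim_m (1 − (ωq)^{p^m})/(1 − q^{p^m})` exists with `L ≠ 0` and
`I = lim_m (1/[p^m]_q) Σ_{j<p^m} ω^j f(a + p^n j)` exists, the limits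
`N = lim_m (1/[p^{m+n}]_Q) Σ_{j<p^m} W^{a+p^n j} f(a + p^n j)` and
`D = lim_m (1/[p^{m+n}]_Q) Σ_{j<p^m} W^{a+p^n j} Q^{a+p^n j}` both exist,
`D ≠ 0`, and `N / D = ((1 − ωq)/((1 − q) L)) · Q^{−a} · I`.

`ℂ_p` is modelled as a complete nonarchimedean normed field `K`;
`[x]_q = (1 - q^x)/(1 - q)`.
-/

open Filter

theorem ne_zero_of_norm_one_sub_lt_one {K : Type*} [NormedField K] {x : K}
    (hx : ‖1 - x‖ < 1) : x ≠ 0 := by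
  rintro rfl
  simp at hx

theorem inv_qAnalogue_mul {K : Type*} [Field K] (Q : K) {k x : ℕ} (hk : Q ^ k ≠ 1) :
    (qAnalogue Q (k * x))⁻¹ = (1 - Q) / (1 - Q ^ k) * (qAnalogue (Q ^ k) x)⁻¹ := by
  have h : 1 - Q ^ k ≠ 0 := sub_ne_zero.mpr hk.symm
  simp only [qAnalogue, inv_div, pow_mul]
  field_simp

theorem maximal_operator_term_eq
    (p : ℕ) [Fact p.Prime] {K : Type*} [NormedField K] [IsUltrametricDist K]
    [CompleteSpace K]
    (W Q : K) (hW : ‖1 - W‖ < 1) (hQ : ‖1 - Q‖ < 1)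
    (n a : ℕ) (ha : a < p ^ n)
    (ω q : K) (hω : ω = W ^ p ^ n) (hq : q = Q ^ p ^ n)
    (hQ1 : Q ≠ 1) (hωq : ω * q ≠ 1) (hqm : ∀ m : ℕ, q ^ p ^ m ≠ 1)
    (f : ℤ_[p] → K) (L I : K) (hL0 : L ≠ 0)
    (hL : Tendsto (fun m => (1 - (ω * q) ^ p ^ m) / (1 - q ^ p ^ m)) atTop (nhds L))
    (hI : Tendsto
      (fun m => (qAnalogue q (p ^ m))⁻¹ *
        ∑ j ∈ Finset.range (p ^ m), ω ^ j * f ((a + p ^ n * j : ℕ) : ℤ_[p]))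
      atTop (nhds I)) :
    ∃ N D : K,
      Tendsto
        (fun m => (qAnalogue Q (p ^ (m + n)))⁻¹ *
          ∑ j ∈ Finset.range (p ^ m),
            W ^ (a + p ^ n * j) * f ((a + p ^ n * j : ℕ) : ℤ_[p]))
        atTop (nhds N) ∧
      Tendsto
        (fun m => (qAnalogue Q (p ^ (m + n)))⁻¹ *
          ∑ j ∈ Finset.range (p ^ m), W ^ (a + p ^ n * j) * Q ^ (a + p ^ n * j))
        atTop (nhds D) ∧
      D ≠ 0 ∧
      N / D = (1 - ω * q) / ((1 - q) * L) * Q ^ (-(a : ℤ)) * I := by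
  have hW0 : W ≠ 0 := ne_zero_of_norm_one_sub_lt_one hW
  have hQ0 : Q ≠ 0 := ne_zero_of_norm_one_sub_lt_one hQ
  have hQ1' : 1 - Q ≠ 0 := sub_ne_zero.mpr hQ1.symm
  have hq1 : q ≠ 1 := by simpa using hqm 0
  have hq1' : 1 - q ≠ 0 := sub_ne_zero.mpr hq1.symm
  have hωq' : 1 - ω * q ≠ 0 := sub_ne_zero.mpr hωq.symm
  have hinv (m : ℕ) : (qAnalogue Q (p ^ (m + n)))⁻¹ =
      (1 - Q) / (1 - q) * (qAnalogue q (p ^ m))⁻¹ := by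
    rw [add_comm, pow_add, inv_qAnalogue_mul Q (hq ▸ hq1), hq]
  refine ⟨W ^ a * ((1 - Q) / (1 - q)) * I,
    (W * Q) ^ a * (1 - Q) / (1 - ω * q) * L, ?_, ?_, ?_, ?_⟩
  · refine (hI.const_mul (W ^ a * ((1 - Q) / (1 - q)))).congr fun m => ?_
    have hsum : ∑ j ∈ Finset.range (p ^ m),
        W ^ (a + p ^ n * j) * f ((a + p ^ n * j : ℕ) : ℤ_[p]) =
        W ^ a * ∑ j ∈ Finset.range (p ^ m), ω ^ j * f ((a + p ^ n * j : ℕ) : ℤ_[p]) := by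
      rw [Finset.mul_sum]
      refine Finset.sum_congr rfl fun j _ => ?_
      rw [pow_add, pow_mul, ← hω, mul_assoc]
    rw [hsum, hinv]
    ring
  · refine (hL.const_mul ((W * Q) ^ a * (1 - Q) / (1 - ω * q))).congr fun m => ?_
    have hsum : ∑ j ∈ Finset.range (p ^ m), W ^ (a + p ^ n * j) * Q ^ (a + p ^ n * j) =
        (W * Q) ^ a * ((1 - (ω * q) ^ p ^ m) / (1 - ω * q)) := by
      rw [← neg_div_neg_eq, neg_sub, neg_sub, ← geom_sum_eq hωq, Finset.mul_sum]
      refine Finset.sum_congr rfl fun j _ => ?_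
      rw [← mul_pow, pow_add, pow_mul, mul_pow W Q (p ^ n), ← hω, ← hq]
    have hqm' : 1 - q ^ p ^ m ≠ 0 := sub_ne_zero.mpr (hqm m).symm
    rw [hsum, hinv, qAnalogue, inv_div]
    field_simp
  · have hWQ : (W * Q) ^ a ≠ 0 := pow_ne_zero _ (mul_ne_zero hW0 hQ0)
    exact mul_ne_zero (div_ne_zero (mul_ne_zero hWQ hQ1') hωq') hL0
  · rw [zpow_neg, zpow_natCast, mul_pow]
    field_simp
end

section
/- Let p be a prime and let q, ω ∈ ℂ_p be 1-units with ωq ≠ 1, q^{p^m} ≠ 1 for all m ∈ ℕ, and such that the limit L = lim_{m→∞} (1 − (ωq)^{p^m})/(1 − q^{p^m}) exists with L ≠ 0. Then there exists a constant K ≥ 0, depending only on p, q, ω, such that for every Lipschitz function f : ℤ_p → ℂ_p, every n ∈ ℕ, every a ∈ ℕ with 0 ≤ a < p^n, and all 1-units W, Q ∈ ℂ_p with W^{p^n} = ω and Q^{p^n} = q for which the limit I = lim_{m→∞} (1/[p^m]_q) Σ_{j=0}^{p^m−1} ω^j f(a + p^n j) exists, the maximal-operator term T_n(a) = ( (1 −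 ωq) / ( (1 − q) L ) ) · Q^{−a} · I satisfies |T_n(a)|_p ≤ K · ‖f‖₁. In other words, the weighted q-Hardy–Littlewood-type maximal operator M^{(ω)}_{p,q} is bounded from the space of Lipschitz (uniformly differentiable) functions on ℤ_p, with norm ‖·‖₁, into the space of p-adically sup-norm-bounded functions on ℤ_p. -/
/-!
STATEMENT 9: boundedness of the weighted `q`-Hardy–Littlewood-type maximal
operator: for 1-units `q, ω` with `ωq ≠ 1`, `q^{p^m} ≠ 1` for all `m`, and
`L = lim_m (1 − (ωq)^{p^m})/(1 − q^{p^m})` existing and nonzero, there is a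
constant `C ≥ 0`, depending only on `p, q, ω`, such that every term
`T_n(a) = ((1 − ωq)/((1 − q)L)) · Q^{−a} · I` of the maximal operator of a
Lipschitz function `f` satisfies `|T_n(a)|_p ≤ C · ‖f‖₁`, where
`‖f‖₁ = max(‖f‖_∞, ‖Δ₁f‖_∞)` and `Δ₁f(m, x) = (f(x+m) − f(x))/m`.

`ℂ_p` is modelled as a complete nonarchimedean normed field `K` admitting an
isometric ring embedding `ι` of `ℚ_[p]`; `[x]_q = (1 - q^x)/(1 - q)`.
-/

open Filter

/-- The sup-norm `‖f‖_∞ = sup_{x ∈ ℤ_p} |f(x)|_p`. -/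
noncomputable def supNorm (p : ℕ) [Fact p.Prime] {K : Type*} [NormedField K]
    (f : ℤ_[p] → K) : ℝ :=
  ⨆ x : ℤ_[p], ‖f x‖

/-- The norm `‖Δ₁f‖_∞` of the difference quotient `Δ₁f(m, x) = (f(x+m) − f(x))/m`. -/
noncomputable def diffQuotNorm (p : ℕ) [Fact p.Prime] {K : Type*} [NormedField K]
    (ι : ℚ_[p] →+* K) (f : ℤ_[p] → K) : ℝ :=
  ⨆ (m : ℤ_[p]) (_ : m ≠ 0) (x : ℤ_[p]), ‖(f (x + m) - f x) / ι (m : ℚ_[p])‖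

/-- The Lipschitz norm `‖f‖₁ = ‖f‖_∞ ∨ ‖Δ₁f‖_∞`. -/
noncomputable def lipNorm (p : ℕ) [Fact p.Prime] {K : Type*} [NormedField K]
    (ι : ℚ_[p] →+* K) (f : ℤ_[p] → K) : ℝ :=
  max (supNorm p f) (diffQuotNorm p ι f)

section

variable {K : Type*} [NormedField K] [IsUltrametricDist K]

theorem norm_eq_one_of_norm_one_sub_lt_one {u : K} (hu : ‖1 - u‖ < 1) : ‖u‖ = 1 := by
  have h := IsUltrametricDist.norm_add_eq_max_of_norm_ne_norm (x := 1) (y := -(1 - u))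
    (by rw [norm_neg, norm_one]; exact hu.ne')
  rwa [norm_neg, norm_one, max_eq_left hu.le, neg_sub, add_sub_cancel] at h

theorem norm_one_sub_pow_le {u : K} (hu : ‖1 - u‖ < 1) (i : ℕ) :
    ‖1 - u ^ i‖ ≤ ‖1 - u‖ := by
  have hu1 := norm_eq_one_of_norm_one_sub_lt_one hu
  rw [← mul_neg_geom_sum, norm_mul]
  refine mul_le_of_le_one_right (norm_nonneg _) ?_
  exact IsUltrametricDist.norm_sum_le_of_forall_le_of_nonneg zero_le_one
    fun j _ => by simp [hu1]

theorem norm_geom_sum_sub_natCast_le {u : K} (hu : ‖1 - u‖ < 1) (k : ℕ) :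
    ‖∑ i ∈ Finset.range k, u ^ i - (k : K)‖ ≤ ‖1 - u‖ := by
  have h : ∑ i ∈ Finset.range k, u ^ i - (k : K) = ∑ i ∈ Finset.range k, (u ^ i - 1) := by
    simp
  rw [h]
  refine IsUltrametricDist.norm_sum_le_of_forall_le_of_nonneg (norm_nonneg _) fun i _ => ?_
  rw [norm_sub_rev]
  exact norm_one_sub_pow_le hu i

theorem norm_geom_sum_le_max {u : K} (hu : ‖1 - u‖ < 1) (k : ℕ) :
    ‖∑ i ∈ Finset.range k, u ^ i‖ ≤ max ‖(k : K)‖ ‖1 - u‖ := by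
  have h := IsUltrametricDist.norm_add_le_max (k : K) (∑ i ∈ Finset.range k, u ^ i - (k : K))
  rw [add_sub_cancel] at h
  exact h.trans (max_le_max le_rfl (norm_geom_sum_sub_natCast_le hu k))

theorem norm_one_sub_pow_eq {u : K} {k : ℕ} (hk : ‖(k : K)‖ ≤ 1) (hu : ‖1 - u‖ < ‖(k : K)‖) :
    ‖1 - u ^ k‖ = ‖1 - u‖ * ‖(k : K)‖ := by
  rw [← mul_neg_geom_sum, norm_mul]
  congr 1
  have h := (norm_geom_sum_sub_natCast_le (hu.trans_le hk) k).trans_lt hu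
  have h2 := IsUltrametricDist.norm_add_eq_max_of_norm_ne_norm h.ne'
  rwa [add_sub_cancel, max_eq_left h.le] at h2

theorem norm_one_sub_pow_pow_le {u : K} (hu : ‖1 - u‖ < 1) (k m : ℕ) :
    ‖1 - u ^ k ^ m‖ ≤ max ‖(k : K)‖ ‖1 - u‖ ^ m := by
  induction m with
  | zero => simpa using hu.le
  | succ m ih =>
    have h1 := norm_one_sub_pow_le hu (k ^ m)
    rw [pow_succ, pow_mul, ← mul_neg_geom_sum, norm_mul, pow_succ]
    refine mul_le_mul ih ?_ (norm_nonneg _) (by positivity)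
    exact (norm_geom_sum_le_max (h1.trans_lt hu) k).trans (max_le_max le_rfl h1)

theorem tendsto_norm_one_sub_pow_pow {u : K} (hu : ‖1 - u‖ < 1) {k : ℕ} (hk : ‖(k : K)‖ < 1) :
    Tendsto (fun m => ‖1 - u ^ k ^ m‖) atTop (nhds 0) :=
  squeeze_zero (fun _ => norm_nonneg _) (norm_one_sub_pow_pow_le hu k)
    (tendsto_pow_atTop_nhds_zero_of_lt_one (by positivity) (max_lt hk hu))

theorem norm_one_sub_pow_pow_eq {u : K} {k N : ℕ} (hk : ‖(k : K)‖ ≤ 1)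
    (hN : ∀ m ≥ N, ‖1 - u ^ k ^ m‖ < ‖(k : K)‖) {m : ℕ} (hm : N ≤ m) :
    ‖1 - u ^ k ^ m‖ = ‖1 - u ^ k ^ N‖ * ‖(k : K)‖ ^ (m - N) := by
  induction m, hm using Nat.le_induction with
  | base => simp
  | succ m hm ih =>
    rw [pow_succ, pow_mul, norm_one_sub_pow_eq hk (hN m hm), ih, Nat.succ_sub hm, pow_succ,
      mul_assoc]

theorem sum_range_mul_eq_sum_sum {M : Type*} [AddCommMonoid M] (h : ℕ → M) (N k : ℕ) :
    ∑ j ∈ Finset.range (N * k), h j =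
      ∑ i ∈ Finset.range k, ∑ j ∈ Finset.range N, h (N * i + j) := by
  induction k with
  | zero => simp
  | succ k ih => rw [Nat.mul_succ, Finset.sum_range_add, ih, Finset.sum_range_succ]

theorem norm_weighted_sum_le {ω : K} (hω : ‖1 - ω‖ < 1) {k N : ℕ} (hk : ‖(k : K)‖ ≤ 1)
    (hk0 : 0 < ‖(k : K)‖) (hN : ∀ m ≥ N, ‖1 - ω ^ k ^ m‖ < ‖(k : K)‖)
    {F : ℝ} {g : ℕ → K} (hg : ∀ j, ‖g j‖ ≤ F)
    (hg' : ∀ m i j, ‖g (k ^ m * i + j) - g j‖ ≤ ‖(k : K)‖ ^ m * F)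
    {m : ℕ} (hm : N ≤ m) :
    ‖∑ j ∈ Finset.range (k ^ m), ω ^ j * g j‖ ≤ ‖(k : K)‖⁻¹ * ‖(k : K)‖ ^ (m - N) * F := by
  have hω1 := norm_eq_one_of_norm_one_sub_lt_one hω
  have hF : 0 ≤ F := (norm_nonneg _).trans (hg 0)
  have hinv : 1 ≤ ‖(k : K)‖⁻¹ := (one_le_inv₀ hk0).2 hk
  induction m, hm using Nat.le_induction with
  | base =>
    refine (IsUltrametricDist.norm_sum_le_of_forall_le_of_nonneg hF fun j _ => ?_).trans ?_
    · simpa [hω1] using hg j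
    · simpa using le_mul_of_one_le_left hF hinv
  | succ m hm ih =>
    have hsplit : ∑ j ∈ Finset.range (k ^ (m + 1)), ω ^ j * g j =
        (∑ j ∈ Finset.range (k ^ m), ω ^ j * g j) * ∑ i ∈ Finset.range k, (ω ^ k ^ m) ^ i +
          ∑ i ∈ Finset.range k, ∑ j ∈ Finset.range (k ^ m),
            ω ^ (k ^ m * i + j) * (g (k ^ m * i + j) - g j) := by
      rw [pow_succ, sum_range_mul_eq_sum_sum, Finset.mul_sum, ← Finset.sum_add_distrib]
      refine Finset.sum_congr rfl fun i _ => ?_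
      rw [Finset.sum_mul, ← Finset.sum_add_distrib]
      refine Finset.sum_congr rfl fun j _ => ?_
      rw [← pow_mul, pow_add]
      ring
    have hgeom : ‖∑ i ∈ Finset.range k, (ω ^ k ^ m) ^ i‖ ≤ ‖(k : K)‖ :=
      (norm_geom_sum_le_max ((hN m hm).trans_le hk) k).trans (max_le le_rfl (hN m hm).le)
    rw [hsplit, Nat.succ_sub hm, pow_succ]
    refine (IsUltrametricDist.norm_add_le_max _ _).trans (max_le ?_ ?_)
    · rw [norm_mul]
      calc _ ≤ ‖(k : K)‖⁻¹ * ‖(k : K)‖ ^ (m - N) * F * ‖(k : K)‖ := by gcongr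
        _ = _ := by ring
    · refine IsUltrametricDist.norm_sum_le_of_forall_le_of_nonneg (by positivity) fun i _ =>
        IsUltrametricDist.norm_sum_le_of_forall_le_of_nonneg (by positivity) fun j _ => ?_
      rw [norm_mul, norm_pow, hω1, one_pow, one_mul]
      calc _ ≤ ‖(k : K)‖ ^ m * F := hg' m i j
        _ ≤ ‖(k : K)‖ ^ (m - N) * F := by
          gcongr ?_ * F
          exact pow_le_pow_of_le_one hk0.le hk (Nat.sub_le _ _)
        _ = _ := by field_simp

end

theorem norm_le_lipNorm (p : ℕ) [Fact p.Prime] {K : Type*} [NormedField K]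
    (ι : ℚ_[p] →+* K) {f : ℤ_[p] → K} {M : ℝ}
    (hf : ∀ x y : ℤ_[p], ‖f x - f y‖ ≤ M * ‖x - y‖) (x : ℤ_[p]) :
    ‖f x‖ ≤ lipNorm p ι f := by
  refine le_trans (le_ciSup (f := fun x => ‖f x‖) ⟨‖f 0‖ + |M|, ?_⟩ x) (le_max_left _ _)
  rintro _ ⟨y, rfl⟩
  have h1 : ‖f y‖ ≤ ‖f 0‖ + ‖f y - f 0‖ := norm_le_norm_add_norm_sub' _ _
  have h2 : M * ‖y - 0‖ ≤ |M| * 1 :=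
    mul_le_mul (le_abs_self M) (PadicInt.norm_le_one _) (norm_nonneg _) (abs_nonneg _)
  have := hf y 0
  dsimp only
  linarith

theorem norm_sub_le_lipNorm_mul (p : ℕ) [Fact p.Prime] {K : Type*} [NormedField K]
    (ι : ℚ_[p] →+* K)
    (hι : ∀ x : ℚ_[p], ‖ι x‖ = ‖x‖) {f : ℤ_[p] → K} {M : ℝ}
    (hf : ∀ x y : ℤ_[p], ‖f x - f y‖ ≤ M * ‖x - y‖) (x m : ℤ_[p]) :
    ‖f (x + m) - f x‖ ≤ ‖m‖ * lipNorm p ι f := by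
  rcases eq_or_ne m 0 with rfl | hm
  · simp
  have hle : ∀ m : ℤ_[p], m ≠ 0 → ∀ x,
      ‖(f (x + m) - f x) / ι (m : ℚ_[p])‖ ≤ |M| := by
    intro m hm x
    have hpos : 0 < ‖m‖ := norm_pos_iff.2 hm
    rw [norm_div, hι, ← PadicInt.norm_def, div_le_iff₀ hpos]
    have := hf (x + m) x
    rw [add_sub_cancel_left] at this
    exact this.trans (by gcongr; exact le_abs_self M)
  have h1 : ‖(f (x + m) - f x) / ι (m : ℚ_[p])‖ ≤ lipNorm p ι f := by
    refine le_trans ?_ (le_max_right _ _)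
    refine le_trans ?_ (le_ciSup (f := fun m : ℤ_[p] => ⨆ (_ : m ≠ 0) (x : ℤ_[p]),
      ‖(f (x + m) - f x) / ι (m : ℚ_[p])‖) ⟨|M|, ?_⟩ m)
    · rw [ciSup_pos hm]
      refine le_ciSup (f := fun x => ‖(f (x + m) - f x) / ι (m : ℚ_[p])‖) ⟨|M|, ?_⟩ x
      rintro _ ⟨y, rfl⟩
      exact hle m hm y
    · rintro _ ⟨m, rfl⟩
      exact Real.iSup_le (fun hm => Real.iSup_le (hle m hm) (abs_nonneg _)) (abs_nonneg _)
  rwa [norm_div, hι, ← PadicInt.norm_def, div_le_iff₀ (norm_pos_iff.2 hm), mul_comm] at h1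

theorem maximal_operator_bounded
    (p : ℕ) [Fact p.Prime] {K : Type*} [NormedField K] [IsUltrametricDist K]
    [CompleteSpace K] (ι : ℚ_[p] →+* K) (hι : ∀ x : ℚ_[p], ‖ι x‖ = ‖x‖)
    (q ω : K) (hq : ‖1 - q‖ < 1) (hω : ‖1 - ω‖ < 1)
    (hωq : ω * q ≠ 1) (hqm : ∀ m : ℕ, q ^ p ^ m ≠ 1)
    (L : K) (hL0 : L ≠ 0)
    (hL : Tendsto (fun m => (1 - (ω * q) ^ p ^ m) / (1 - q ^ p ^ m)) atTop (nhds L)) :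
    ∃ C : ℝ, 0 ≤ C ∧
      ∀ (f : ℤ_[p] → K), (∃ M : ℝ, ∀ x y : ℤ_[p], ‖f x - f y‖ ≤ M * ‖x - y‖) →
        ∀ (n a : ℕ), a < p ^ n →
          ∀ (W Q : K), ‖1 - W‖ < 1 → ‖1 - Q‖ < 1 →
            W ^ p ^ n = ω → Q ^ p ^ n = q →
              ∀ I : K,
                Tendsto
                  (fun m => (qAnalogue q (p ^ m))⁻¹ *
                    ∑ j ∈ Finset.range (p ^ m),
                      ω ^ j * f ((a + p ^ n * j : ℕ) : ℤ_[p]))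
                  atTop (nhds I) →
                ‖(1 - ω * q) / ((1 - q) * L) * Q ^ (-(a : ℤ)) * I‖ ≤
                  C * lipNorm p ι f := by
  have hp : ‖(p : K)‖ = (p : ℝ)⁻¹ := by
    rw [← map_natCast ι p, hι, Padic.norm_p]
  have hp1 : 1 < (p : ℝ) := by exact_mod_cast (Fact.out : p.Prime).one_lt
  have hk0 : 0 < ‖(p : K)‖ := by rw [hp]; positivity
  have hk1 : ‖(p : K)‖ < 1 := by rw [hp]; exact inv_lt_one_of_one_lt₀ hp1
  obtain ⟨N, hN⟩ := eventually_atTop.1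
    (((tendsto_norm_one_sub_pow_pow hq hk1).eventually_lt_const hk0).and
      ((tendsto_norm_one_sub_pow_pow hω hk1).eventually_lt_const hk0))
  have hD : 0 < ‖1 - q ^ p ^ N‖ := norm_pos_iff.2 (sub_ne_zero.2 (hqm N).symm)
  refine ⟨‖(1 - ω * q) / ((1 - q) * L)‖ * (‖1 - q‖ * ‖(p : K)‖⁻¹ / ‖1 - q ^ p ^ N‖),
    by positivity, ?_⟩
  rintro f ⟨M, hf⟩ n a - W Q - hQ - - I hI
  have hpow : ∀ m i j : ℕ, ((a + p ^ n * (p ^ m * i + j) : ℕ) : ℤ_[p]) =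
      ((a + p ^ n * j : ℕ) : ℤ_[p]) + (p : ℤ_[p]) ^ m * ((p ^ n * i : ℕ) : ℤ_[p]) := by
    intro m i j
    push_cast
    ring
  have hF : 0 ≤ lipNorm p ι f := (norm_nonneg _).trans (norm_le_lipNorm p ι hf 0)
  have hIle : ‖I‖ ≤ ‖1 - q‖ * ‖(p : K)‖⁻¹ / ‖1 - q ^ p ^ N‖ * lipNorm p ι f := by
    refine le_of_tendsto hI.norm (eventually_atTop.2 ⟨N, fun m hm => ?_⟩)
    have hS := norm_weighted_sum_le hω hk1.le hk0 (fun m hm => (hN m hm).2)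
      (g := fun j => f ((a + p ^ n * j : ℕ) : ℤ_[p]))
      (fun j => norm_le_lipNorm p ι hf _) (fun m i j => by
        rw [hpow]
        refine (norm_sub_le_lipNorm_mul p ι hι hf _ _).trans ?_
        gcongr
        rw [norm_mul, norm_pow, PadicInt.norm_p, hp]
        exact mul_le_of_le_one_right (by positivity) (PadicInt.norm_le_one _)) hm
    rw [norm_mul, qAnalogue, inv_div, norm_div,
      norm_one_sub_pow_pow_eq hk1.le (fun m hm => (hN m hm).1) hm]
    refine (mul_le_mul_of_nonneg_left hS (by positivity)).trans_eq ?_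
    have := hk0.ne'
    field_simp
  rw [norm_mul, norm_mul, norm_zpow, norm_eq_one_of_norm_one_sub_lt_one hQ, one_zpow, mul_one,
    mul_assoc]
  exact mul_le_mul_of_nonneg_left hIle (norm_nonneg _)
end
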